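/- Let G = (V,E) be a connected graph with colouring ω from colour-set C. For all u,v ∈ V and d ∈ C with u ≠ v, the connection cost satisfies the recursion m(u,v,d) = min over edges xx' ∈ E of min( m(u,x,d) + m(x',v,d), min over d' ∈ C of 1 + m(u,x,d') + m(x',v,d') ), with base case m(v,v,d) = 0 if ω(v) = d and 1 otherwise. -/

import Mathlib

namespace Flood

variable {V C : Type*}

/-- Two vertices are joined by an edge inside a monochromatic class. -/
def monoAdj (G : SimpleGraph V) (ω : V → C) (a b : V) : Prop :=
  G.Adj a b ∧ ω a = ω b

/-- `u` and `v` lie in a common monochromatic component of the colouring `ω`. -/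
def monoLinked (G : SimpleGraph V) (ω : V → C) (u v : V) : Prop :=
  Relation.ReflTransGen (monoAdj G ω) u v

/-- One flooding move: recolour the monochromatic component of `v` with colour `d`. -/
noncomputable def floodMove (G : SimpleGraph V) (ω : V → C) (v : V) (d : C) : V → C :=
  fun u => @ite _ (monoLinked G ω v u) (Classical.propDecidable _) d (ω u)

/-- Apply a sequence of flooding moves. -/
noncomputable def floodSeq (G : SimpleGraph V) (ω : V → C) (S : List (V × C)) : V → C :=
  S.foldl (fun ω' m => floodMove G ω' m.1 m.2) ω

/-- The sequence `S` floods `G`, i.e. makes it monochromatic. -/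
def Floods (G : SimpleGraph V) (ω : V → C) (S : List (V × C)) : Prop :=
  ∀ a b, floodSeq G ω S a = floodSeq G ω S b

/-- Minimum number of moves needed to make `G` monochromatic. -/
noncomputable def floodCost (G : SimpleGraph V) (ω : V → C) : ℕ :=
  sInf {k | ∃ S, S.length = k ∧ Floods G ω S}

/-- Minimum number of moves needed to make `G` monochromatic in colour `d`. -/
noncomputable def floodCostIn (G : SimpleGraph V) (ω : V → C) (d : C) : ℕ :=
  sInf {k | ∃ S, S.length = k ∧ ∀ a, floodSeq G ω S a = d}

/-- The sequence `S` links `u` and `v`. -/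
def Links (G : SimpleGraph V) (ω : V → C) (S : List (V × C)) (u v : V) : Prop :=
  monoLinked G (floodSeq G ω S) u v

/-- Minimum number of moves needed to link `u` and `v`. -/
noncomputable def linkCost (G : SimpleGraph V) (ω : V → C) (u v : V) : ℕ :=
  sInf {k | ∃ S, S.length = k ∧ Links G ω S u v}

/-- Minimum number of moves needed to link `u` and `v` in a monochromatic
component of colour `d`. -/
noncomputable def linkCostIn (G : SimpleGraph V) (ω : V → C) (u v : V) (d : C) : ℕ :=
  sInf {k | ∃ S, S.length = k ∧ Links G ω S u v ∧ floodSeq G ω S u = d}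


end Flood

open Flood

namespace Flood

variable {V C : Type*}

/-- `RecolorCost l d k`: the word `l` of colours can be turned into a constant word of colour `d`
by at most `k` recolourings of constant blocks, organised along a binary tree. -/
inductive RecolorCost : List C → C → ℕ → Prop
  | nil (d : C) (k : ℕ) : RecolorCost [] d k
  | single (c : C) (k : ℕ) : RecolorCost [c] c k
  | append {l l' : List C} {d : C} {a b : ℕ} :
      RecolorCost l d a → RecolorCost l' d b → RecolorCost (l ++ l') d (a + b)
  | recolor {l : List C} {d' : C} {a : ℕ} (d : C) :
      RecolorCost l d' a → RecolorCost l d (a + 1)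

namespace RecolorCost

theorem mono {l : List C} {d : C} {a b : ℕ} (h : RecolorCost l d a) (hab : a ≤ b) :
    RecolorCost l d b := by
  induction h generalizing b with
  | nil d k => exact .nil d b
  | single c k => exact .single c b
  | @append l l' d a' b' _ h₂ ih₁ ih₂ =>
    have := (ih₁ le_rfl).append (ih₂ (b := b - a') (by omega))
    rwa [show a' + (b - a') = b by omega] at this
  | @recolor l d' a d _ ih =>
    have := (ih (b := b - 1) (by omega)).recolor d
    rwa [show b - 1 + 1 = b by omega] at this

theorem of_forall_eq {l : List C} {d : C} (h : ∀ c ∈ l, c = d) (k : ℕ) : RecolorCost l d k := by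
  induction l with
  | nil => exact .nil d k
  | cons c l ih =>
    obtain rfl : c = d := h c (by simp)
    simpa using (single c 0).append (ih fun x hx => h x (by simp [hx]))

theorem sublist {l l' : List C} {d : C} {k : ℕ} (h : RecolorCost l d k) (hl : l'.Sublist l) :
    RecolorCost l' d k := by
  induction h generalizing l' with
  | nil d k => exact of_forall_eq (by simp_all) k
  | single c k =>
    exact of_forall_eq (fun x hx => by simpa using hl.subset hx) k
  | append _ _ ih₁ ih₂ =>
    obtain ⟨l₁, l₂, rfl, h₁, h₂⟩ := List.sublist_append_iff.1 hl
    exact (ih₁ h₁).append (ih₂ h₂)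
  | recolor d _ ih => exact (ih hl).recolor d

/-- Replacing a letter `e` of a word by a word that can be recoloured to `e`. -/
theorem subst {α β μ : List C} {d e : C} {j k : ℕ} (h : RecolorCost (α ++ e :: β) d k)
    (hμ : RecolorCost μ e j) : RecolorCost (α ++ μ ++ β) d (k + j) := by
  generalize hl : α ++ e :: β = l at h
  induction h generalizing α β with
  | nil d k => simp at hl
  | single c k =>
    obtain ⟨rfl, rfl, rfl⟩ : α = [] ∧ e = c ∧ β = [] := by
      cases α <;> simp_all
    simpa using hμ.mono (by omega)
  | @append l₁ l₂ d a b h₁ h₂ ih₁ ih₂ =>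
    rcases List.append_eq_append_iff.1 hl with ⟨γ, rfl, hγ⟩ | ⟨γ, rfl, hγ⟩
    · cases γ with
      | nil =>
        have := h₁.append (ih₂ (α := []) (β := β) (by simpa using hγ))
        simpa [add_assoc] using this
      | cons x γ =>
        simp only [List.cons_append, List.cons.injEq] at hγ
        obtain ⟨rfl, rfl⟩ := hγ
        have := (ih₁ rfl).append h₂
        simpa [add_assoc, add_comm, add_left_comm] using this
    · have := h₁.append (ih₂ (α := γ) (β := β) hγ.symm)
      simpa [add_assoc] using this
  | @recolor l d' a d _ ih =>
    have := (ih hl).recolor d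
    rwa [show a + j + 1 = a + 1 + j by omega] at this

/-- A word is constant, or a constant block of it can be recoloured first. -/
theorem exists_block {l : List C} {d : C} {k : ℕ} (h : RecolorCost l d k) :
    (∀ c ∈ l, c = d) ∨ ∃ (α : List C) (c : C) (μ β : List C) (e : C) (j : ℕ),
      l = α ++ c :: (μ ++ β) ∧ (∀ x ∈ μ, x = c) ∧ k = j + 1 ∧ RecolorCost (α ++ e :: β) d j := by
  induction h with
  | nil d k => simp
  | single c k => simp
  | @append l₁ l₂ d a b h₁ h₂ ih₁ ih₂ =>
    rcases ih₁ with ih₁ | ⟨α, c, μ, β, e, j, rfl, hμ, rfl, hj⟩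
    · rcases ih₂ with ih₂ | ⟨α, c, μ, β, e, j, rfl, hμ, rfl, hj⟩
      · left
        intro c hc
        rcases List.mem_append.1 hc with hc | hc
        exacts [ih₁ c hc, ih₂ c hc]
      · exact .inr ⟨l₁ ++ α, c, μ, β, e, a + j, by simp, hμ, by omega, by
          simpa using h₁.append hj⟩
    · exact .inr ⟨α, c, μ, β ++ l₂, e, j + b, by simp, hμ, by omega, by
        simpa using hj.append h₂⟩
  | @recolor l d' a d _ ih =>
    rcases ih with ih | ⟨α, c, μ, β, e, j, rfl, hμ, rfl, hj⟩
    · cases l with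
      | nil => simp
      | cons c μ =>
        obtain rfl := ih c (by simp)
        exact .inr ⟨[], c, μ, [], d, a, by simp, fun x hx => ih x (by simp [hx]), rfl, .single d a⟩
    · exact .inr ⟨α, c, μ, β, e, j + 1, rfl, hμ, rfl, hj.recolor d⟩

/-- The optimal recolouring of a word with at least two letters splits the word. -/
theorem exists_split {l : List C} {d : C} {k : ℕ} (h : RecolorCost l d k) (hl : 2 ≤ l.length) :
    ∃ l₁ l₂ : List C, l = l₁ ++ l₂ ∧ l₁ ≠ [] ∧ l₂ ≠ [] ∧ ∃ a b : ℕ,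
      (RecolorCost l₁ d a ∧ RecolorCost l₂ d b ∧ a + b ≤ k ∨
        ∃ d', RecolorCost l₁ d' a ∧ RecolorCost l₂ d' b ∧ 1 + a + b ≤ k) := by
  induction h with
  | nil d k => simp at hl
  | single c k => simp at hl
  | @append l₁ l₂ d a b h₁ h₂ ih₁ ih₂ =>
    rcases eq_or_ne l₁ [] with rfl | hl₁
    · obtain ⟨m₁, m₂, e, n₁, n₂, a', b', h'⟩ := ih₂ (by simpa using hl)
      refine ⟨m₁, m₂, by simpa using e, n₁, n₂, a', b', ?_⟩
      rcases h' with ⟨p, q, r⟩ | ⟨d', p, q, r⟩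
      exacts [.inl ⟨p, q, by omega⟩, .inr ⟨d', p, q, by omega⟩]
    rcases eq_or_ne l₂ [] with rfl | hl₂
    · obtain ⟨m₁, m₂, e, n₁, n₂, a', b', h'⟩ := ih₁ (by simpa using hl)
      refine ⟨m₁, m₂, by simpa using e, n₁, n₂, a', b', ?_⟩
      rcases h' with ⟨p, q, r⟩ | ⟨d', p, q, r⟩
      exacts [.inl ⟨p, q, by omega⟩, .inr ⟨d', p, q, by omega⟩]
    exact ⟨l₁, l₂, rfl, hl₁, hl₂, a, b, .inl ⟨h₁, h₂, le_rfl⟩⟩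
  | @recolor l d' a d _ ih =>
    obtain ⟨m₁, m₂, e, n₁, n₂, a', b', h'⟩ := ih hl
    refine ⟨m₁, m₂, e, n₁, n₂, a', b', .inr ?_⟩
    rcases h' with ⟨p, q, r⟩ | ⟨d'', p, q, r⟩
    exacts [⟨d', p, q, by omega⟩, ⟨d'', p, q, by omega⟩]

theorem of_length (l : List C) (d : C) : RecolorCost l d l.length := by
  induction l with
  | nil => exact .nil d 0
  | cons c l ih =>
    have := ((single c 0).recolor d).append ih
    simpa [add_comm] using this

end RecolorCost

/-- `p` is the list of vertices of a walk from `u` to `v`. -/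
def IsVertexWalk (G : SimpleGraph V) (u v : V) (p : List V) : Prop :=
  p.head? = some u ∧ p.getLast? = some v ∧ p.IsChain G.Adj

variable {G : SimpleGraph V} {ω : V → C}

theorem IsVertexWalk.append {u x x' v : V} {p q : List V} (hp : IsVertexWalk G u x p)
    (h : G.Adj x x') (hq : IsVertexWalk G x' v q) : IsVertexWalk G u v (p ++ q) := by
  obtain ⟨p₁, p₂, p₃⟩ := hp
  obtain ⟨q₁, q₂, q₃⟩ := hq
  refine ⟨by simp [p₁], by simp [q₂], List.isChain_append.2 ⟨p₃, q₃, ?_⟩⟩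
  simp_all

theorem IsVertexWalk.exists_of_append {u v : V} {p q : List V} (h : IsVertexWalk G u v (p ++ q))
    (hp : p ≠ []) (hq : q ≠ []) :
    ∃ x x', G.Adj x x' ∧ IsVertexWalk G u x p ∧ IsVertexWalk G x' v q := by
  obtain ⟨h₁, h₂, h₃⟩ := h
  obtain ⟨c₁, c₂, c₃⟩ := List.isChain_append.1 h₃
  have hx : p.getLast? = some (p.getLast hp) := List.getLast?_eq_some_getLast hp
  have hx' : q.head? = some (q.head hq) := List.head?_eq_some_head hq
  refine ⟨p.getLast hp, q.head hq, c₃ _ hx _ hx', ⟨?_, hx, c₁⟩, ⟨hx', ?_, c₂⟩⟩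
  · rwa [List.head?_append_of_ne_nil _ hp] at h₁
  · rwa [List.getLast?_append_of_ne_nil _ hq] at h₂

/-- Replacing the part of a walk between `s` and `t`. -/
theorem IsVertexWalk.splice {u v s t : V} {A κ B R R' : List V}
    (h : IsVertexWalk G u v (A ++ s :: R)) (hR : s :: R = R' ++ t :: B)
    (hκ : IsVertexWalk G s t κ) : IsVertexWalk G u v (A ++ (κ ++ B)) := by
  have hκ₀ : κ ≠ [] := by rintro rfl; simp [IsVertexWalk] at hκ
  obtain ⟨k₁, k₂, k₃⟩ := hκ
  obtain ⟨h₁, h₂, h₃⟩ := h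
  obtain ⟨c₁, c₂, c₃⟩ := List.isChain_append.1 h₃
  obtain ⟨-, c₄, -⟩ := List.isChain_append.1 (hR ▸ c₂)
  have h₄ : (t :: B).getLast? = some v := by
    rw [hR] at h₂
    simpa using h₂
  clear hR c₂ h₃
  refine ⟨?_, ?_, List.isChain_append.2 ⟨c₁, List.isChain_append.2 ⟨k₃, c₄.tail, ?_⟩, ?_⟩⟩
  · cases A <;> simp_all
  · cases B <;> simp_all
  · cases B <;> simp_all
  · simp_all

theorem isVertexWalk_support {u v : V} (p : G.Walk u v) :
    IsVertexWalk G u v p.support := by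
  induction p with
  | nil => simp [IsVertexWalk]
  | cons h p ih => simpa using IsVertexWalk.append (p := [_]) (by simp [IsVertexWalk]) h ih

theorem monoAdj_symm {a b : V} (h : monoAdj G ω a b) : monoAdj G ω b a := ⟨h.1.symm, h.2.symm⟩

theorem monoLinked.symm {a b : V} (h : monoLinked G ω a b) : monoLinked G ω b a := by
  induction h with
  | refl => exact .refl
  | tail _ h ih => exact .head (monoAdj_symm h) ih

theorem monoLinked.trans {a b c : V} (h : monoLinked G ω a b) (h' : monoLinked G ω b c) :
    monoLinked G ω a c := Relation.ReflTransGen.trans h h'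

theorem monoLinked.color_eq {a b : V} (h : monoLinked G ω a b) : ω a = ω b := by
  induction h with
  | refl => rfl
  | tail _ h ih => exact ih.trans h.2

theorem monoLinked.exists_isVertexWalk {s t : V} (h : monoLinked G ω s t) :
    ∃ κ, IsVertexWalk G s t κ ∧ ∀ w ∈ κ, monoLinked G ω s w := by
  induction h with
  | refl => exact ⟨[s], by simp [IsVertexWalk], by simpa using .refl⟩
  | @tail b c hb hc ih =>
    obtain ⟨κ, hκ, hl⟩ := ih
    refine ⟨κ ++ [c], hκ.append hc.1 (by simp [IsVertexWalk]), ?_⟩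
    intro w hw
    rcases List.mem_append.1 hw with hw | hw
    · exact hl w hw
    · obtain rfl : w = c := by simpa using hw
      exact .tail hb hc

theorem monoLinked_of_isChain {u : V} {p : List V} (h : (u :: p).IsChain G.Adj)
    (hc : ∀ w ∈ p, ω w = ω u) : ∀ w ∈ p, monoLinked G ω u w := by
  induction p generalizing u with
  | nil => simp
  | cons x p ih =>
    rw [List.isChain_cons_cons] at h
    have hx : monoAdj G ω u x := ⟨h.1, (hc x (by simp)).symm⟩
    intro w hw
    rcases List.mem_cons.1 hw with rfl | hw
    · exact .single hx
    · exact .head hx (ih h.2 (fun w hw => by rw [hc w (by simp [hw]), hx.2]) w hw)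

theorem exists_first {K : V → Prop} {p : List V} (h : ∃ m ∈ p, K m) :
    ∃ A s R, p = A ++ s :: R ∧ K s ∧ ∀ a ∈ A, ¬ K a := by
  induction p with
  | nil => simp at h
  | cons x p ih =>
    by_cases hx : K x
    · exact ⟨[], x, p, rfl, hx, by simp⟩
    · obtain ⟨A, s, R, rfl, hs, hA⟩ := ih (by simpa [hx] using h)
      exact ⟨x :: A, s, R, rfl, hs, by simpa [hx] using hA⟩

theorem exists_last {K : V → Prop} {p : List V} (h : ∃ m ∈ p, K m) :
    ∃ R t B, p = R ++ t :: B ∧ K t ∧ ∀ b ∈ B, ¬ K b := by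
  obtain ⟨A, s, R, e, hs, hA⟩ := exists_first (p := p.reverse) (by simpa using h)
  exact ⟨R.reverse, s, A.reverse, by simpa using congrArg List.reverse e, hs, by simpa using hA⟩

theorem sublist_left_of_append_eq {K : V → Prop} {A R P Q : List V} {s m : V}
    (h : A ++ s :: R = P ++ m :: Q) (hm : K m) (hA : ∀ a ∈ A, ¬ K a) : A.Sublist P := by
  rcases List.append_eq_append_iff.1 h with ⟨γ, rfl, hγ⟩ | ⟨γ, rfl, hγ⟩
  · exact List.sublist_append_left _ _
  · cases γ with
    | nil => simp
    | cons x γ =>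
      simp only [List.cons_append, List.cons.injEq] at hγ
      exact absurd hm (hA m (by simp [hγ.1]))

theorem sublist_right_of_append_eq {K : V → Prop} {B R P Q : List V} {t m : V}
    (h : R ++ t :: B = P ++ m :: Q) (hm : K m) (hB : ∀ b ∈ B, ¬ K b) : B.Sublist Q := by
  have := sublist_left_of_append_eq (K := K) (A := B.reverse) (P := Q.reverse)
    (R := R.reverse) (Q := P.reverse) (s := t) (m := m)
    (by simpa using congrArg List.reverse h) hm (by simpa using hB)
  simpa using this

/-- A walk meeting a monochromatic component can be rerouted so that it visits the component in
a single block. -/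
theorem IsVertexWalk.exists_reroute {u v x : V} {p : List V} (hp : IsVertexWalk G u v p)
    (h : ∃ m ∈ p, monoLinked G ω x m) :
    ∃ A κ B, IsVertexWalk G u v (A ++ (κ ++ B)) ∧ (∀ w ∈ κ, monoLinked G ω x w) ∧
      (∀ a ∈ A, ¬ monoLinked G ω x a) ∧ (∀ b ∈ B, ¬ monoLinked G ω x b) ∧
      ∀ P m Q, p = P ++ m :: Q → monoLinked G ω x m → A.Sublist P ∧ B.Sublist Q := by
  obtain ⟨A, s, R, rfl, hs, hA⟩ := exists_first h
  obtain ⟨R', t, B, hR, ht, hB⟩ := exists_last (p := s :: R) (K := monoLinked G ω x)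
    ⟨s, by simp, hs⟩
  obtain ⟨κ, hκ, hl⟩ := (hs.symm.trans ht).exists_isVertexWalk
  refine ⟨A, κ, B, hp.splice hR hκ, fun w hw => hs.trans (hl w hw), hA, hB, ?_⟩
  intro P m Q e hm
  have e' : (A ++ R') ++ t :: B = P ++ m :: Q := by rw [← e, hR, List.append_assoc]
  exact ⟨sublist_left_of_append_eq e hm hA, sublist_right_of_append_eq e' hm hB⟩

theorem floodMove_of_linked {x w : V} {e : C} (h : monoLinked G ω x w) :
    floodMove G ω x e w = e := if_pos h

theorem floodMove_of_not_linked {x w : V} {e : C} (h : ¬ monoLinked G ω x w) :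
    floodMove G ω x e w = ω w := if_neg h

theorem exists_links_of_recolorCost {u v : V} {d : C} {k : ℕ} {ω : V → C} {p : List V}
    (hp : IsVertexWalk G u v p) (h : RecolorCost (p.map ω) d k) :
    ∃ S : List (V × C), S.length ≤ k ∧ Links G ω S u v ∧ floodSeq G ω S u = d := by
  induction k using Nat.strong_induction_on generalizing ω p with
  | _ k ih =>
  rcases h.exists_block with hd | ⟨α, c, μ, β, e, j, hl, hμ, rfl, hj⟩
  · refine ⟨[], by simp, ?_⟩
    obtain ⟨h₁, h₂, h₃⟩ := hp
    cases p with
    | nil => simp at h₁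
    | cons x p =>
      obtain rfl : x = u := by simpa using h₁
      have hx : ω x = d := hd _ (by simp)
      refine ⟨?_, hx⟩
      rcases List.mem_cons.1 (List.mem_of_getLast? h₂) with rfl | hv
      · exact .refl
      · exact monoLinked_of_isChain h₃
          (fun w hw => (hd _ (by simp; grind)).trans hx.symm) v hv
  · obtain ⟨P, p', rfl, hP, hp'⟩ := List.map_eq_append_iff.1 hl
    obtain ⟨m, p'', rfl, hm, hp''⟩ := List.map_eq_cons_iff.1 hp'
    obtain ⟨M, Q, rfl, hM, hQ⟩ := List.map_eq_append_iff.1 hp''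
    subst hP hm hM hQ
    have hMK : ∀ w ∈ M, monoLinked G ω m w := by
      refine monoLinked_of_isChain ?_ (fun w hw => hμ _ (List.mem_map_of_mem hw))
      have := (List.isChain_append.1 hp.2.2).2.1
      rw [← List.cons_append] at this
      exact (List.isChain_append.1 this).1
    obtain ⟨A, κ, B, hw, hκ, hA, hB, hs⟩ :=
      hp.exists_reroute (ω := ω) (x := m) ⟨m, by simp, .refl⟩
    obtain ⟨hAP, hBQ⟩ := hs _ _ _ rfl .refl
    obtain ⟨B₁, B₂, rfl, hB₁, hB₂⟩ := List.sublist_append_iff.1 hBQ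
    obtain rfl : B₁ = [] := by
      rw [List.eq_nil_iff_forall_not_mem]
      exact fun b hb => hB b (by simp [hb]) (hMK b (hB₁.subset hb))
    have hcost : RecolorCost (A.map ω ++ e :: B₂.map ω) d j :=
      hj.sublist ((hAP.map ω).append ((hB₂.map ω).cons_cons e))
    have hcost' : RecolorCost ((A ++ (κ ++ ([] ++ B₂))).map (floodMove G ω m e)) d j := by
      have hκ' : RecolorCost (κ.map (floodMove G ω m e)) e 0 :=
        .of_forall_eq (by
          simp only [List.mem_map]
          rintro _ ⟨w, hw, rfl⟩
          exact floodMove_of_linked (hκ w hw)) 0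
      have hA' : A.map (floodMove G ω m e) = A.map ω :=
        List.map_congr_left fun a ha => floodMove_of_not_linked (hA a ha)
      have hB' : B₂.map (floodMove G ω m e) = B₂.map ω :=
        List.map_congr_left fun b hb => floodMove_of_not_linked (hB b (by simp [hb]))
      simpa [hA', hB'] using hcost.subst hκ'
    obtain ⟨S, hS, hS'⟩ := ih j (by omega) hw hcost'
    exact ⟨(m, e) :: S, by simpa using hS, hS'⟩

theorem exists_recolorCost_of_links {u v : V} {d : C} {ω : V → C} {S : List (V × C)}
    (h : Links G ω S u v) (hd : floodSeq G ω S u = d) :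
    ∃ p, IsVertexWalk G u v p ∧ RecolorCost (p.map ω) d S.length := by
  induction S generalizing ω with
  | nil =>
    obtain ⟨κ, hκ, hl⟩ := monoLinked.exists_isVertexWalk (ω := ω) h
    refine ⟨κ, hκ, .of_forall_eq ?_ _⟩
    simp only [List.mem_map]
    rintro _ ⟨w, hw, rfl⟩
    exact (hl w hw).color_eq.symm.trans hd
  | cons a S ih =>
    obtain ⟨x, e⟩ := a
    obtain ⟨p, hp, hc⟩ := ih (ω := floodMove G ω x e) h hd
    by_cases hK : ∃ m ∈ p, monoLinked G ω x m
    · obtain ⟨A, κ, B, hw, hκ, hA, hB, hs⟩ := hp.exists_reroute hK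
      obtain ⟨m, hmp, hm⟩ := hK
      obtain ⟨P, Q, rfl⟩ := List.append_of_mem hmp
      obtain ⟨hAP, hBQ⟩ := hs _ _ _ rfl hm
      have hcost := hc.sublist ((hAP.append (hBQ.cons_cons m)).map (floodMove G ω x e))
      have hA' : A.map (floodMove G ω x e) = A.map ω :=
        List.map_congr_left fun a ha => floodMove_of_not_linked (hA a ha)
      have hB' : B.map (floodMove G ω x e) = B.map ω :=
        List.map_congr_left fun b hb => floodMove_of_not_linked (hB b hb)
      rw [List.map_append, List.map_cons, hA', hB', floodMove_of_linked hm] at hcost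
      have hκ' : RecolorCost (κ.map ω) (ω x) 0 :=
        .of_forall_eq (by
          simp only [List.mem_map]
          rintro _ ⟨w, hw, rfl⟩
          exact (hκ w hw).color_eq.symm) 0
      exact ⟨_, hw, by simpa using hcost.subst (hκ'.recolor e)⟩
    · refine ⟨p, hp, ?_⟩
      have : p.map (floodMove G ω x e) = p.map ω :=
        List.map_congr_left fun a ha => floodMove_of_not_linked fun h => hK ⟨a, ha, h⟩
      rw [this] at hc
      exact hc.mono (by simp)

theorem linkCostIn_le {u v : V} {d : C} {k : ℕ} {p : List V}
    (hp : IsVertexWalk G u v p) (h : RecolorCost (p.map ω) d k) : linkCostIn G ω u v d ≤ k := by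
  obtain ⟨S, hS, hS'⟩ := exists_links_of_recolorCost hp h
  exact le_trans (Nat.sInf_le ⟨S, rfl, hS'⟩) hS

theorem exists_recolorCost_linkCostIn (hG : G.Connected) (ω : V → C) (u v : V) (d : C) :
    ∃ p, IsVertexWalk G u v p ∧ RecolorCost (p.map ω) d (linkCostIn G ω u v d) := by
  obtain ⟨q⟩ := hG.preconnected u v
  obtain ⟨S, -, hS⟩ := exists_links_of_recolorCost (isVertexWalk_support q)
    (RecolorCost.of_length (q.support.map ω) d)
  obtain ⟨T, hT, hl, hd⟩ : linkCostIn G ω u v d ∈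
      {k | ∃ S : List (V × C), S.length = k ∧ Links G ω S u v ∧ floodSeq G ω S u = d} :=
    Nat.sInf_mem ⟨_, S, rfl, hS⟩
  rw [← hT]
  exact exists_recolorCost_of_links hl hd

theorem linkCostIn_self [DecidableEq C] (G : SimpleGraph V) (ω : V → C) (v : V) (d : C) :
    linkCostIn G ω v v d = if ω v = d then 0 else 1 := by
  have hv : IsVertexWalk G v v [v] := by simp [IsVertexWalk]
  split_ifs with h
  · exact Nat.le_zero.1 (linkCostIn_le hv (.of_forall_eq (by simpa using h) 0))
  · refine le_antisymm (linkCostIn_le hv (RecolorCost.of_length _ d)) (Nat.one_le_iff_ne_zero.2 ?_)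
    intro h₀
    rcases Nat.sInf_eq_zero.1 h₀ with ⟨S, hS, -, hd⟩ | h₁
    · obtain rfl := List.length_eq_zero_iff.1 hS
      exact h hd
    · obtain ⟨S, -, hS⟩ := exists_links_of_recolorCost hv (RecolorCost.of_length ([v].map ω) d)
      exact (h₁ ▸ (⟨S, rfl, hS⟩ : S.length ∈ {k | ∃ S : List (V × C), S.length = k ∧
        Links G ω S v v ∧ floodSeq G ω S v = d}) : S.length ∈ (∅ : Set ℕ))

end Flood

/-- the connection costs satisfy the dynamic-programming
recursion: `m(v,v,d)` is `0` or `1` according to whether `v` already has colour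
`d`, and for `u ≠ v`, `m(u,v,d)` is the minimum over edges `xx'` of
`m(u,x,d) + m(x',v,d)` and of `1 + m(u,x,d') + m(x',v,d')` over colours `d'`. -/
theorem linkCost_recursion {V C : Type*} [Fintype V] [DecidableEq C]
    (G : SimpleGraph V) (hG : G.Connected) (ω : V → C) :
    (∀ (v : V) (d : C),
        linkCostIn G ω v v d = if ω v = d then 0 else 1) ∧
    (∀ (u v : V) (d : C), u ≠ v →
        linkCostIn G ω u v d =
          sInf {k | ∃ x x' : V, G.Adj x x' ∧
            (k = linkCostIn G ω u x d + linkCostIn G ω x' v d ∨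
              ∃ d' : C,
                k = 1 + linkCostIn G ω u x d' + linkCostIn G ω x' v d')}) := by
  refine ⟨linkCostIn_self G ω, fun u v d huv => ?_⟩
  have hle : ∀ k, (∃ x x' : V, G.Adj x x' ∧
      (k = linkCostIn G ω u x d + linkCostIn G ω x' v d ∨
        ∃ d' : C, k = 1 + linkCostIn G ω u x d' + linkCostIn G ω x' v d')) →
      linkCostIn G ω u v d ≤ k := by
    rintro k ⟨x, x', hx, rfl | ⟨d', rfl⟩⟩
    · obtain ⟨p, hp, hpc⟩ := exists_recolorCost_linkCostIn hG ω u x d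
      obtain ⟨q, hq, hqc⟩ := exists_recolorCost_linkCostIn hG ω x' v d
      exact linkCostIn_le (hp.append hx hq) (by simpa using hpc.append hqc)
    · obtain ⟨p, hp, hpc⟩ := exists_recolorCost_linkCostIn hG ω u x d'
      obtain ⟨q, hq, hqc⟩ := exists_recolorCost_linkCostIn hG ω x' v d'
      refine linkCostIn_le (hp.append hx hq) ?_
      rw [List.map_append, add_assoc, add_comm 1]
      exact (hpc.append hqc).recolor d
  obtain ⟨p, hp, hc⟩ := exists_recolorCost_linkCostIn hG ω u v d
  have hlen : 2 ≤ (p.map ω).length := by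
    obtain ⟨h₁, h₂, -⟩ := hp
    rcases p with _ | ⟨a, _ | ⟨b, p⟩⟩
    · simp at h₁
    · simp_all
    · simp
  obtain ⟨l₁, l₂, hl, hn₁, hn₂, a, b, h⟩ := hc.exists_split hlen
  obtain ⟨p₁, p₂, rfl, rfl, rfl⟩ := List.map_eq_append_iff.1 hl
  obtain ⟨x, x', hx, hp₁, hp₂⟩ := hp.exists_of_append (by simpa using hn₁) (by simpa using hn₂)
  apply le_antisymm
  · exact le_csInf ⟨_, x, x', hx, .inl rfl⟩ hle
  · rcases h with ⟨h₁, h₂, hab⟩ | ⟨d', h₁, h₂, hab⟩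
    · refine le_trans (Nat.sInf_le ⟨x, x', hx, .inl rfl⟩) (le_trans ?_ hab)
      exact add_le_add (linkCostIn_le hp₁ h₁) (linkCostIn_le hp₂ h₂)
    · refine le_trans (Nat.sInf_le ⟨x, x', hx, .inr ⟨d', rfl⟩⟩) (le_trans ?_ hab)
      exact add_le_add (add_le_add le_rfl (linkCostIn_le hp₁ h₁)) (linkCostIn_le hp₂ h₂)
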